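/- Let R be a finite local ring with identity, with |R| = q^n for some integer n ≥ 2, whose residue field R/J has q elements, where J = J(R) is the Jacobson radical. Then P_x(R) = (q^{n−1} + q − 2)/q^{n+1} for every nonzero x ∈ J if and only if |R| = q² (that is, n = 2). -/

import Mathlib

/-- The multiplication probability of a finite ring `R` at `x`:
`P_x(R) = |{(a,b) ∈ R × R : a*b = x}| / |R|²`. -/
noncomputable def mulProb (R : Type*) [Ring R] (x : R) : ℚ :=
  (Nat.card {p : R × R // p.1 * p.2 = x} : ℚ) / (Nat.card R : ℚ) ^ 2

/-- The Jacobson radical of a ring, as a two-sided ideal. -/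
abbrev jacobsonRadical (R : Type*) [Ring R] : TwoSidedIdeal R :=
  (⊥ : TwoSidedIdeal R).jacobson

/-- The residue ring `R/J(R)` of a ring modulo its Jacobson radical. -/
abbrev residueRing (R : Type*) [Ring R] : Type _ :=
  (jacobsonRadical R).ringCon.Quotient

theorem aux_mem {R : Type*} [Ring R] [Finite R] [IsLocalRing R] (x : R) :
    x ∈ jacobsonRadical R ↔ ¬ IsUnit x := by
  rw [TwoSidedIdeal.mem_jacobson_iff]
  constructor
  · rintro h ⟨u, rfl⟩
    obtain ⟨z, hz⟩ := h (-((u⁻¹ : Rˣ) : R))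
    rw [TwoSidedIdeal.mem_bot] at hz
    have : (-1 : R) = 0 := by
      rw [← hz]; simp [mul_assoc]
    exact one_ne_zero (neg_eq_zero.mp this)
  · intro hx y
    have h1 : (y * x + 1) + (-(y * x)) = 1 := by abel
    rcases IsLocalRing.isUnit_or_isUnit_of_add_one h1 with h | h
    · obtain ⟨u, hu⟩ := h
      refine ⟨((u⁻¹ : Rˣ) : R), ?_⟩
      rw [TwoSidedIdeal.mem_bot]
      have : ((u⁻¹ : Rˣ) : R) * (y * x + 1) = 1 := by rw [← hu]; simp
      rw [← this]; noncomm_ring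
    · exfalso
      apply hx
      obtain ⟨u, hu⟩ := h
      have : (-(((u⁻¹ : Rˣ) : R) * y)) * x = 1 := by
        have h2 : ((u⁻¹ : Rˣ) : R) * (-(y * x)) = 1 := by rw [← hu]; simp
        rw [← h2]; noncomm_ring
      exact IsUnit.of_mul_eq_one _ (mul_eq_one_symm this)

theorem aux_card {G H : Type*} [AddGroup G] [AddGroup H] (f : G →+ H) :
    Nat.card G = Nat.card f.range * Nat.card f.ker := by
  rw [AddSubgroup.card_eq_card_quotient_mul_card_addSubgroup f.ker,
    Nat.card_congr (QuotientAddGroup.quotientKerEquivRange f).toEquiv]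

theorem aux_cardJ {R : Type*} [Ring R] [Finite R] [IsLocalRing R] :
    Nat.card R = Nat.card (residueRing R) * Nat.card {x : R // ¬ IsUnit x} := by
  have h := aux_card ((jacobsonRadical R).ringCon.mk' : R →+* residueRing R).toAddMonoidHom
  rw [h]
  congr 1
  · apply Nat.card_congr
    refine (Equiv.subtypeUnivEquiv ?_)
    intro y
    obtain ⟨x, rfl⟩ := RingCon.mk'_surjective (jacobsonRadical R).ringCon y
    exact ⟨x, rfl⟩
  · apply Nat.card_congr
    apply Equiv.subtypeEquivRight
    intro x
    rw [← aux_mem, TwoSidedIdeal.mem_iff, AddMonoidHom.mem_ker]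
    exact RingCon.eq _

theorem aux_units {R : Type*} [Ring R] [Finite R] :
    Nat.card R = Nat.card Rˣ + Nat.card {x : R // ¬ IsUnit x} := by
  classical
  rw [Nat.card_congr (Equiv.sumCompl (fun x : R => IsUnit x)).symm, Nat.card_sum]
  congr 1
  refine Nat.card_congr (Equiv.ofBijective (fun u : Rˣ => (⟨u, u.isUnit⟩ : {x : R // IsUnit x})) ?_).symm
  constructor
  · intro u v h
    exact Units.ext (congrArg Subtype.val h)
  · rintro ⟨x, u, rfl⟩
    exact ⟨u, rfl⟩

theorem aux_count {R : Type*} [Ring R] [Finite R] (x : R) (hx : ¬ IsUnit x)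
    (h : ∀ a b : R, ¬ IsUnit a → ¬ IsUnit b → a * b ≠ x) :
    Nat.card {p : R × R // p.1 * p.2 = x} = 2 * Nat.card Rˣ := by
  rw [two_mul, ← Nat.card_sum]
  let f : Rˣ ⊕ Rˣ → {p : R × R // p.1 * p.2 = x} := Sum.elim
    (fun u => ⟨((u : R), ((u⁻¹ : Rˣ) : R) * x), by simp⟩)
    (fun u => ⟨(x * ((u⁻¹ : Rˣ) : R), (u : R)), by simp⟩)
  refine (Nat.card_congr (Equiv.ofBijective f ?_)).symm
  constructor
  · rintro (u | u) (v | v) huv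
    · have := congrArg (fun p => p.1.1) huv
      exact congrArg _ (Units.ext this)
    · exfalso
      have := congrArg (fun p => p.1.1) huv
      have h2 : (u : R) = x * ((v⁻¹ : Rˣ) : R) := this
      apply hx
      rw [(Units.eq_mul_inv_iff_mul_eq v).mp h2 |>.symm]
      exact u.isUnit.mul v.isUnit
    · exfalso
      have := congrArg (fun p => p.1.1) huv
      have h2 : x * ((u⁻¹ : Rˣ) : R) = (v : R) := this
      apply hx
      rw [(Units.eq_mul_inv_iff_mul_eq u).mp h2.symm |>.symm]
      exact v.isUnit.mul u.isUnit
    · have := congrArg (fun p => p.1.2) huv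
      exact congrArg _ (Units.ext this)
  · rintro ⟨⟨a, b⟩, hab⟩
    by_cases ha : IsUnit a
    · obtain ⟨u, rfl⟩ := ha
      refine ⟨Sum.inl u, Subtype.ext (Prod.ext rfl ?_)⟩
      change ((u⁻¹ : Rˣ) : R) * x = b
      rw [← hab]; simp
    · by_cases hb : IsUnit b
      · obtain ⟨u, rfl⟩ := hb
        refine ⟨Sum.inr u, Subtype.ext (Prod.ext ?_ rfl)⟩
        change x * ((u⁻¹ : Rˣ) : R) = a
        rw [← hab]; simp
      · exact absurd hab (h a b ha hb)

theorem aux_nak {R : Type*} [Ring R] [Finite R] [IsLocalRing R] (r a b : R)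
    (ha : ¬ IsUnit a) (h : b = r * (a * b)) : b = 0 := by
  have h1 : (1 - r * a) + r * a = 1 := by abel
  rcases IsLocalRing.isUnit_or_isUnit_of_add_one h1 with h2 | ⟨u, hu⟩
  · apply (h2.mul_right_eq_zero).mp
    rw [sub_mul, one_mul, mul_assoc, ← h, sub_self]
  · exfalso
    apply ha
    have : (((u⁻¹ : Rˣ) : R) * r) * a = 1 := by rw [mul_assoc, ← hu]; simp
    exact IsUnit.of_mul_eq_one _ (mul_eq_one_symm this)

theorem aux_nonunit_mul {R : Type*} [Ring R] [Finite R] (r x : R)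
    (hx : ¬ IsUnit x) : ¬ IsUnit (r * x) := by
  rintro ⟨u, hu⟩
  apply hx
  have : (((u⁻¹ : Rˣ) : R) * r) * x = 1 := by rw [mul_assoc, ← hu]; simp
  exact IsUnit.of_mul_eq_one _ (mul_eq_one_symm this)

theorem aux_exists {R : Type*} [Ring R] [Finite R] [IsLocalRing R]
    (hJ : ∃ x : R, ¬ IsUnit x ∧ x ≠ 0) :
    ∃ x : R, ¬ IsUnit x ∧ x ≠ 0 ∧ ∀ a b : R, ¬ IsUnit a → ¬ IsUnit b → a * b ≠ x := by
  obtain ⟨x, hx, hmax⟩ := Set.exists_max_image {x : R | ¬ IsUnit x ∧ x ≠ 0}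
    (fun x => Nat.card (AddMonoidHom.mulRight x).range) (Set.toFinite _) hJ
  refine ⟨x, hx.1, hx.2, ?_⟩
  rintro a b ha hb hab
  have hb0 : b ≠ 0 := by
    rintro rfl
    exact hx.2 (by rw [← hab, mul_zero])
  have h1 := hmax b ⟨hb, hb0⟩
  have hle : (AddMonoidHom.mulRight x).range ≤ (AddMonoidHom.mulRight b).range := by
    rintro _ ⟨r, rfl⟩
    exact ⟨r * a, by simp [← hab, mul_assoc]⟩
  have heq := AddSubgroup.eq_of_le_of_card_ge hle h1
  have hbm : b ∈ (AddMonoidHom.mulRight x).range := by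
    rw [heq]; exact ⟨1, by simp⟩
  obtain ⟨r, hr⟩ := hbm
  exact hb0 (aux_nak r a b ha (by rw [hab]; exact hr.symm))

theorem aux_two {R : Type*} [Ring R] [Finite R] [IsLocalRing R]
    {q : ℕ} (hR : Nat.card R = q ^ 2) (hq : 0 < q) (hJ : Nat.card {x : R // ¬ IsUnit x} = q)
    (x : R) (hx : ¬ IsUnit x) (hx0 : x ≠ 0) (a b : R) (ha : ¬ IsUnit a) (hb : ¬ IsUnit b) :
    a * b ≠ x := by
  intro hab
  have hb0 : b ≠ 0 := by
    rintro rfl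
    exact hx0 (by rw [← hab, mul_zero])
  have hc := aux_card (AddMonoidHom.mulRight x)
  have hk : Nat.card (AddMonoidHom.mulRight x).ker ≤ q := by
    rw [← hJ]
    refine Nat.card_mono (s := ((AddMonoidHom.mulRight x).ker : Set R)) (t := {x : R | ¬ IsUnit x}) (Set.toFinite _) ?_
    intro r hr hu
    have hr' : r * x = 0 := hr
    exact hx0 ((hu.mul_right_eq_zero).mp hr')
  have hr : q ≤ Nat.card (AddMonoidHom.mulRight x).range := by
    rw [hR] at hc
    by_contra! hlt
    nlinarith
  have hsub : ((AddMonoidHom.mulRight x).range : Set R) ⊆ {x : R | ¬ IsUnit x} := by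
    rintro _ ⟨r, rfl⟩
    exact aux_nonunit_mul r x hx
  have heq : ((AddMonoidHom.mulRight x).range : Set R) = {x : R | ¬ IsUnit x} := by
    apply Set.eq_of_subset_of_ncard_le hsub _ (Set.toFinite _)
    rw [← Nat.card_coe_set_eq, ← Nat.card_coe_set_eq]
    exact hJ.le.trans hr
  have hbm : b ∈ ((AddMonoidHom.mulRight x).range : Set R) := by
    rw [heq]; exact hb
  obtain ⟨r, hr⟩ := hbm
  exact hb0 (aux_nak r a b ha (by rw [hab]; exact hr.symm))

/-- Let `R` be a finite local ring with `|R| = qⁿ`, `n ≥ 2`, whose residue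
field `R/J` has `q` elements. Then `P_x(R) = (q^{n−1} + q − 2)/q^{n+1}` for every nonzero
`x ∈ J` if and only if `|R| = q²`. -/
theorem mulProb_upper_eq_iff_card_eq_sq
    {R : Type*} [Ring R] [Finite R] [IsLocalRing R] {q n : ℕ} (hn : 2 ≤ n)
    (hcard : Nat.card R = q ^ n) (hres : Nat.card (residueRing R) = q) :
    (∀ x ∈ jacobsonRadical R, x ≠ 0 →
        mulProb R x = ((q : ℚ) ^ (n - 1) + (q : ℚ) - 2) / (q : ℚ) ^ (n + 1)) ↔
      Nat.card R = q ^ 2 := by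
  have hR2 : 1 < Nat.card R := Finite.one_lt_card
  have hq : 2 ≤ q := by
    by_contra! hlt
    interval_cases q
    · rw [zero_pow (by omega)] at hcard; omega
    · rw [one_pow] at hcard; omega
  obtain ⟨m, rfl⟩ : ∃ m, n = m + 2 := ⟨n - 2, by omega⟩
  have hJ : Nat.card {x : R // ¬ IsUnit x} = q ^ (m + 1) := by
    have h := aux_cardJ (R := R)
    rw [hcard, hres, show m + 2 = (m + 1) + 1 from rfl, pow_succ', ] at h
    exact (Nat.eq_of_mul_eq_mul_left (by omega) h).symm
  have hU : (Nat.card Rˣ : ℚ) = (q : ℚ) ^ (m + 2) - (q : ℚ) ^ (m + 1) := by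
    have h := aux_units (R := R)
    rw [hcard, hJ] at h
    have h' : ((q ^ (m + 2) : ℕ) : ℚ) = ((Nat.card Rˣ + q ^ (m + 1) : ℕ) : ℚ) := by rw [h]
    push_cast at h'
    linarith
  have hq0 : (q : ℚ) ≠ 0 := by
    have : q ≠ 0 := by omega
    exact_mod_cast this
  have hP : ∀ x : R, ¬ IsUnit x → (∀ a b : R, ¬ IsUnit a → ¬ IsUnit b → a * b ≠ x) →
      mulProb R x = (2 * (q : ℚ) - 2) / (q : ℚ) ^ (m + 2 + 1) := by
    intro x hx h
    rw [mulProb, aux_count x hx h, hcard]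
    push_cast
    rw [hU]
    field_simp
    ring
  constructor
  · intro h
    have hne : ∃ x : R, ¬ IsUnit x ∧ x ≠ 0 := by
      have h1 : 1 < Nat.card {x : R // ¬ IsUnit x} := by
        rw [hJ]; exact Nat.one_lt_pow (by omega) (by omega)
      haveI := Finite.one_lt_card_iff_nontrivial.mp h1
      obtain ⟨y, hy⟩ := exists_ne (⟨0, not_isUnit_zero⟩ : {x : R // ¬ IsUnit x})
      exact ⟨y.1, y.2, fun h0 => hy (Subtype.ext h0)⟩
    obtain ⟨x, hx, hx0, hxx⟩ := aux_exists hne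
    have h1 := h x ((aux_mem x).mpr hx) hx0
    rw [hP x hx hxx, div_left_inj' (pow_ne_zero _ hq0)] at h1
    have h2 : (q : ℚ) ^ (m + 1) = (q : ℚ) ^ 1 := by
      rw [show m + 2 - 1 = m + 1 by omega] at h1
      linarith
    have h3 : q ^ (m + 1) = q ^ 1 := by exact_mod_cast h2
    have h4 := Nat.pow_right_injective hq h3
    rw [hcard]
    congr 1
    omega
  · intro h x hx hx0
    have hm : m = 0 := by
      rw [hcard] at h
      have := Nat.pow_right_injective hq h
      omega
    subst hm
    have hx' := (aux_mem x).mp hx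
    rw [hP x hx' (aux_two h (by omega) (by simpa using hJ) x hx' hx0)]
    congr 1
    simp only [zero_add, Nat.reduceSub, pow_one]
    ring
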